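/- Suppose OPT is partitioned into disjoint sets B₀,…,B_{ℓ-1}, and for each i there is a set C_i with w₂(OPT ∩ B_i) ≤ α·w₂(C_i), where w₂(u)·2^i ≤ w(u) ≤ 2·w₂(u)·2^i for all u ∈ B_i ∪ C_i. Then if T has w(T) ≥ max_i w(C_i), it holds that w(OPT) ≤ 2ℓα·w(T). -/

import Mathlib

/-- If `OPT` is partitioned into disjoint sets `B 0, …, B (ℓ-1)`, for each
`i` there is `C i` with `w₂(OPT ∩ B i) ≤ α·w₂(C i)`, where
`w₂(u)·2^i ≤ w(u) ≤ 2·w₂(u)·2^i` for all `u ∈ B i ∪ C i`, and `w(T) ≥ w(C i)` for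
every `i`, then `w(OPT) ≤ 2ℓα·w(T)`. -/
theorem stmt_9 {γ : Type*} [DecidableEq γ] (OPT T : Finset γ) (ℓ : ℕ) (hℓ : 1 ≤ ℓ)
    (α : ℝ) (hα : 1 ≤ α) (B C : ℕ → Finset γ) (w w₂ : γ → ℝ)
    (hw : ∀ u, 0 ≤ w u) (hw₂ : ∀ u, 0 ≤ w₂ u)
    (hpart : OPT = (Finset.range ℓ).biUnion B)
    (hdisj : ∀ i < ℓ, ∀ j < ℓ, i ≠ j → Disjoint (B i) (B j))
    (happrox : ∀ i < ℓ, ∑ u ∈ OPT ∩ B i, w₂ u ≤ α * ∑ u ∈ C i, w₂ u)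
    (hrel : ∀ i < ℓ, ∀ u ∈ B i ∪ C i,
      w₂ u * 2 ^ i ≤ w u ∧ w u ≤ 2 * w₂ u * 2 ^ i)
    (hT : ∀ i < ℓ, ∑ u ∈ C i, w u ≤ ∑ u ∈ T, w u) :
    ∑ u ∈ OPT, w u ≤ 2 * ℓ * α * ∑ u ∈ T, w u := by
  have hgroup : ∀ i ∈ Finset.range ℓ, ∑ u ∈ B i, w u ≤ 2 * α * ∑ u ∈ T, w u := by
    intro i hi
    have hiℓ : i < ℓ := Finset.mem_range.mp hi
    have hsub : OPT ∩ B i = B i := by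
      rw [hpart]
      exact Finset.inter_eq_right.mpr (Finset.subset_biUnion_of_mem B hi)
    have hB := happrox i hiℓ
    rw [hsub] at hB
    have hC : (∑ u ∈ C i, w₂ u) * 2 ^ i ≤ ∑ u ∈ C i, w u := by
      rw [Finset.sum_mul]
      exact Finset.sum_le_sum fun u hu => (hrel i hiℓ u (Finset.mem_union_right _ hu)).1
    calc ∑ u ∈ B i, w u ≤ ∑ u ∈ B i, 2 * w₂ u * 2 ^ i :=
          Finset.sum_le_sum fun u hu => (hrel i hiℓ u (Finset.mem_union_left _ hu)).2
      _ = 2 * (∑ u ∈ B i, w₂ u) * 2 ^ i := by rw [← Finset.sum_mul, ← Finset.mul_sum]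
      _ ≤ 2 * (α * ∑ u ∈ C i, w₂ u) * 2 ^ i := by gcongr
      _ = 2 * α * ((∑ u ∈ C i, w₂ u) * 2 ^ i) := by ring
      _ ≤ 2 * α * ∑ u ∈ T, w u := by
          gcongr
          exact hC.trans (hT i hiℓ)
  have hsum : ∑ u ∈ OPT, w u = ∑ i ∈ Finset.range ℓ, ∑ u ∈ B i, w u := by
    rw [hpart]
    exact Finset.sum_biUnion fun i hi j hj hij =>
      hdisj i (by simpa using hi) j (by simpa using hj) hij
  calc ∑ u ∈ OPT, w u = ∑ i ∈ Finset.range ℓ, ∑ u ∈ B i, w u := hsum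
    _ ≤ ∑ _i ∈ Finset.range ℓ, 2 * α * ∑ u ∈ T, w u := Finset.sum_le_sum hgroup
    _ = 2 * ℓ * α * ∑ u ∈ T, w u := by
        rw [Finset.sum_const, Finset.card_range, nsmul_eq_mul]
        ring
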